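/- arXiv:2009.13768 — 4 statements merged into one kernel-verified Lean document; each statement's English description precedes it below -/
import Mathlib

section
/- Starting from the empty Two-Stacks state, for any finite sequence of insert and evict operations in which every evict is applied to a nonempty window and which contains k inserts, the total number of ⊗ invocations performed by all evict operations (i.e., the sum over all flips of the number of elements transferred, each transfer invoking ⊗ once) is at most k; moreover each insert invokes ⊗ exactly once and each query invokes ⊗ exactly once. -/
/-!
STATEMENT 4: Starting from the empty Two-Stacks state, for any finite sequence
of insert and evict operations in which every evict is applied to a nonempty
window and which contains `k` inserts, the total number of `⊗` invocations
performed by all evict operations (i.e., the sum over all flips of the number of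
elements transferred, each transfer invoking `⊗` once) is at most `k`; moreover
each insert invokes `⊗` exactly once and each query invokes `⊗` exactly once.
-/

namespace TwoStacks

variable {M : Type*} [Monoid M]

/-- A Two-Stacks state: the front stack `F` and the back stack `B`. -/
abbrev State (M : Type*) := List (M × M) × List (M × M)

/-- Window operations: insert a value, or evict the oldest value. -/
inductive Op (M : Type*) where
  | ins (v : M)
  | evict

def aggF (F : List (M × M)) : M :=
  match F with
  | [] => 1
  | x :: _ => x.2

def aggB (B : List (M × M)) : M :=
  match B.getLast? with
  | none => 1
  | some x => x.2

/-- The flip loop, iterating over `B` from its top (last) to its bottom. -/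
def flipAux (F : List (M × M)) : List (M × M) → List (M × M)
  | [] => F
  | b :: rest => flipAux ((b.1, b.1 * aggF F) :: F) rest

/-- `evict()`: if `F` is empty, first flip, then pop the top (index 0) of `F`. -/
def evictOp (F B : List (M × M)) : State M :=
  match F with
  | [] => ((flipAux [] B.reverse).tail, ([] : List (M × M)))
  | _ :: F' => (F', B)

/-- One operation applied to a state. -/
def step (s : State M) : Op M → State M
  | .ins v => (s.1, s.2 ++ [(v, aggB s.2 * v)])
  | .evict => evictOp s.1 s.2

/-- Run a sequence of operations from a state. -/
def run (s : State M) : List (Op M) → State M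
  | [] => s
  | o :: rest => run (step s o) rest

/-- Number of `⊗` invocations performed by an evict applied at state `s`:
a flip transfers all `|B|` elements, each transfer invoking `⊗` once. -/
def evictCost (s : State M) : Op M → ℕ
  | .ins _ => 0
  | .evict => match s.1 with
    | [] => s.2.length
    | _ :: _ => 0

/-- Total number of `⊗` invocations performed by all evict operations. -/
def totalEvictCost (s : State M) : List (Op M) → ℕ
  | [] => 0
  | o :: rest => evictCost s o + totalEvictCost (step s o) rest

/-- `insert(v)` appends `(v, aggB ⊗ v)` to `B`, invoking `⊗` exactly once. -/
def insertCost (_s : State M) (_v : M) : ℕ := 1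

/-- `query()` returns `aggF ⊗ aggB`, invoking `⊗` exactly once. -/
def queryCost (_s : State M) : ℕ := 1

/-- The number of inserts in a sequence of operations. -/
def numInserts (ops : List (Op M)) : ℕ :=
  ops.countP (fun o => match o with | .ins _ => true | .evict => false)

theorem totalEvictCost_le (ops : List (Op M)) : ∀ s : State M,
    totalEvictCost s ops ≤ s.2.length + numInserts ops := by
  induction ops with
  | nil => intro s; simp [totalEvictCost]
  | cons o rest ih =>
    rintro ⟨F, B⟩
    have h := ih (step (F, B) o)
    cases o with
    | ins v =>
      simp [totalEvictCost, evictCost, step, numInserts] at h ⊢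
      omega
    | evict =>
      cases F with
      | nil =>
        simp [totalEvictCost, evictCost, step, evictOp, numInserts] at h ⊢
        omega
      | cons x F =>
        simp [totalEvictCost, evictCost, step, evictOp, numInserts] at h ⊢
        omega

theorem amortized_evict_cost (ops : List (Op M))
    (hvalid : ∀ p rest, ops = p ++ Op.evict :: rest →
      (run (([], []) : State M) p).1 ≠ [] ∨ (run (([], []) : State M) p).2 ≠ []) :
    totalEvictCost (([], []) : State M) ops ≤ numInserts ops ∧
    (∀ (s : State M) (v : M), insertCost s v = 1) ∧
    (∀ s : State M, queryCost s = 1) := by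
  refine ⟨?_, fun _ _ => rfl, fun _ => rfl⟩
  simpa using totalEvictCost_le ops (([], []) : State M)

end TwoStacks
end

section
/- Starting from the empty Two-Stacks Lite state, for any finite sequence of insert and evict operations in which every evict is applied to a nonempty window and which contains k inserts, the total number of ⊗ invocations performed by all evict operations (each flip over a deque of length m invoking ⊗ exactly m−1 times) is at most k; moreover each insert invokes ⊗ exactly once and each query invokes ⊗ exactly once. -/
/-!
STATEMENT 8: Starting from the empty Two-Stacks Lite state, for any finite
sequence of insert and evict operations in which every evict is applied to a
nonempty window and which contains `k` inserts, the total number of `⊗`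
invocations performed by all evict operations (each flip over a deque of
length `m` invoking `⊗` exactly `m−1` times) is at most `k`; moreover each
insert invokes `⊗` exactly once and each query invokes `⊗` exactly once.
-/

namespace TwoStacksLite

variable {M : Type*} [Monoid M]

/-- A Two-Stacks Lite state: deque, split index `s`, and `aggB`. -/
abbrev State (M : Type*) := List M × ℕ × M

/-- Window operations: insert a value, or evict the oldest value. -/
inductive Op (M : Type*) where
  | ins (v : M)
  | evict

/-- One flip-loop iteration: replace entry `i` by `(entry i) ⊗ (entry (i+1))`. -/
def upd (l : List M) (i : ℕ) : List M :=
  l.set i (l.getD i 1 * l.getD (i + 1) 1)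

/-- Perform the updates at indices `i, i−1, …, 0`, in that (descending) order. -/
def flipFrom (l : List M) : ℕ → List M
  | 0 => upd l 0
  | i + 1 => flipFrom (upd l (i + 1)) i

/-- The flip loop, for `I = n−2` down to `0` (no iterations when `n ≤ 1`). -/
def flipAll (l : List M) : List M :=
  if l.length ≤ 1 then l else flipFrom l (l.length - 2)

/-- `evict()`: if `s = 0` and `n > 0`, first flip (setting `s ← n`, `aggB ← 1`),
then remove `deque[0]` (decrementing `s`, clamped at 0, and `n` by one). -/
def evictOp (st : State M) : State M :=
  if st.2.1 = 0 then ((flipAll st.1).tail, st.1.length - 1, 1)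
  else (st.1.tail, st.2.1 - 1, st.2.2)

/-- One operation applied to a state. -/
def step (st : State M) : Op M → State M
  | .ins v => (st.1 ++ [v], st.2.1, st.2.2 * v)
  | .evict => evictOp st

/-- Run a sequence of operations from a state. -/
def run (st : State M) : List (Op M) → State M
  | [] => st
  | o :: rest => run (step st o) rest

/-- `⊗` invocations performed by an evict at state `st`: a flip over a deque
of length `m ≥ 1` invokes `⊗` exactly `m − 1` times; a non-flipping evict
invokes `⊗` zero times. -/
def evictCost (st : State M) : Op M → ℕ
  | .ins _ => 0
  | .evict =>
      match st.1 with
      | [] => 0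
      | _ :: _ => if st.2.1 = 0 then st.1.length - 1 else 0

/-- Total number of `⊗` invocations performed by all evict operations. -/
def totalEvictCost (st : State M) : List (Op M) → ℕ
  | [] => 0
  | o :: rest => evictCost st o + totalEvictCost (step st o) rest

/-- `insert(v)` invokes `⊗` exactly once (`aggB ← aggB ⊗ v`). -/
def insertCost (_st : State M) (_v : M) : ℕ := 1

/-- `query()` returns `aggF ⊗ aggB`, invoking `⊗` exactly once. -/
def queryCost (_st : State M) : ℕ := 1

/-- The number of inserts in a sequence of operations. -/
def numInserts (ops : List (Op M)) : ℕ :=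
  ops.countP (fun o => match o with | .ins _ => true | .evict => false)

/-- The empty state. -/
def emptyState : State M := ([], 0, 1)

theorem flipFrom_length (i : ℕ) : ∀ l : List M, (flipFrom l i).length = l.length := by
  induction i with
  | zero => intro l; simp [flipFrom, upd]
  | succ i ih => intro l; simp [flipFrom, ih, upd]

theorem flipAll_length (l : List M) : (flipAll l).length = l.length := by
  unfold flipAll
  split
  · rfl
  · exact flipFrom_length _ _

/-- Amortized bound with potential `n - s`, under the invariant `s ≤ n`. -/
theorem totalEvictCost_le (ops : List (Op M)) : ∀ st : State M, st.2.1 ≤ st.1.length →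
    totalEvictCost st ops ≤ numInserts ops + (st.1.length - st.2.1) := by
  induction ops with
  | nil => intro st _; simp [totalEvictCost]
  | cons o rest ih =>
    rintro ⟨l, s, a⟩ h
    simp only at h
    cases o with
    | ins v =>
      have := ih (step (l, s, a) (.ins v)) (by simp [step]; omega)
      simp [totalEvictCost, evictCost, numInserts, step] at this ⊢
      omega
    | evict =>
      have hn : numInserts (Op.evict :: rest) = numInserts rest := by simp [numInserts]
      by_cases hs : s = 0
      · subst hs
        have := ih (step (l, 0, a) .evict) (by simp [step, evictOp, flipAll_length])
        simp only [totalEvictCost, hn]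
        have hc : evictCost (l, 0, a) (Op.evict : Op M) ≤ l.length := by
          cases l <;> simp [evictCost]
        have hp : (step (l, 0, a) .evict).1.length - (step (l, 0, a) .evict).2.1 = 0 := by
          simp [step, evictOp, flipAll_length]
        omega
      · have := ih (step (l, s, a) .evict) (by simp [step, evictOp, hs]; omega)
        have hc : evictCost (l, s, a) (Op.evict : Op M) = 0 := by
          cases l <;> simp [evictCost, hs]
        have hp : (step (l, s, a) .evict).1.length - (step (l, s, a) .evict).2.1
            = l.length - s := by
          simp [step, evictOp, hs]; omega
        simp only [totalEvictCost, hn]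
        omega

theorem amortized_evict_cost (ops : List (Op M))
    (hvalid : ∀ p rest, ops = p ++ Op.evict :: rest →
      (run (emptyState : State M) p).1 ≠ []) :
    totalEvictCost (emptyState : State M) ops ≤ numInserts ops ∧
    (∀ (st : State M) (v : M), insertCost st v = 1) ∧
    (∀ st : State M, queryCost st = 1) := by
  refine ⟨?_, fun _ _ => rfl, fun _ => rfl⟩
  simpa [emptyState] using totalEvictCost_le ops (emptyState : State M) (by simp [emptyState])

end TwoStacksLite
end

section
/- If a DABA state with window contents v₀,…,v_{n−1} satisfies the DABA partial-aggregate invariants and the DABA size invariants, then: (a) the state obtained by insert(v) satisfies both invariants for the window contents v₀,…,v_{n−1}, v; and (b) if n > 0, the state obtained by evict() satisfies both invariants for the window contents v₁,…,v_{n−1}. -/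
/-!
STATEMENT 11: If a DABA state with window contents `v₀,…,v_{n−1}` satisfies the
DABA partial-aggregate invariants and the DABA size invariants, then: (a) the
state obtained by `insert(v)` satisfies both invariants for the window contents
`v₀,…,v_{n−1}, v`; and (b) if `n > 0`, the state obtained by `evict()`
satisfies both invariants for the window contents `v₁,…,v_{n−1}`.
-/

namespace Daba

variable {M : Type*} [Monoid M]

/-- A DABA state: a deque of `(val, agg)` pairs and pointers `L ≤ R ≤ A ≤ B ≤ n`
(pointer `F` is index `0` and `E` is index `n = q.length`). -/
structure State (M : Type*) where
  q : List (M × M)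
  L : ℕ
  R : ℕ
  A : ℕ
  B : ℕ

variable (s : State M)

/-- `aggB = deque[n−1].agg` if `B < n`, `1` otherwise. -/
def aggB : M :=
  if s.B < s.q.length then (s.q.getD (s.q.length - 1) (1, 1)).2 else 1

/-- `aggL = deque[L].agg` if `L < R`, `1` otherwise. -/
def aggL : M := if s.L < s.R then (s.q.getD s.L (1, 1)).2 else 1

/-- `aggR = deque[A−1].agg` if `R < A`, `1` otherwise. -/
def aggR : M := if s.R < s.A then (s.q.getD (s.A - 1) (1, 1)).2 else 1

/-- `aggA = deque[A].agg` if `A < B`, `1` otherwise. -/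
def aggA : M := if s.A < s.B then (s.q.getD s.A (1, 1)).2 else 1

/-- Overwrite the `agg` field of `deque[i]`, keeping its `val` field. -/
def setAgg (q : List (M × M)) (i : ℕ) (x : M) : List (M × M) :=
  q.set i ((q.getD i (1, 1)).1, x)

/-- `fixup()`: if `B = 0` (singleton case) set `L, R, A, B` all to `n`;
otherwise, if `L = B` (flip) set `L ← 0, A ← n, B ← n`; then if `L = R` (shift)
increment each of `L, R, A` by one; else (shrink) set
`deque[L].agg ← aggL ⊗ aggR ⊗ aggA`, `L ← L + 1`,
`deque[A−1].agg ← deque[A−1].val ⊗ aggA`, `A ← A − 1`. -/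
def fixup (s : State M) : State M :=
  let n := s.q.length
  if s.B = 0 then ⟨s.q, n, n, n, n⟩
  else
    let s1 : State M := if s.L = s.B then ⟨s.q, 0, s.R, n, n⟩ else s
    if s1.L = s1.R then ⟨s1.q, s1.L + 1, s1.R + 1, s1.A + 1, s1.B⟩
    else
      let s2 : State M :=
        ⟨setAgg s1.q s1.L (aggL s1 * aggR s1 * aggA s1), s1.L + 1, s1.R, s1.A, s1.B⟩
      ⟨setAgg s2.q (s2.A - 1) ((s2.q.getD (s2.A - 1) (1, 1)).1 * aggA s2),
        s2.L, s2.R, s2.A - 1, s2.B⟩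

/-- `insert(v)`: append `(v, aggB ⊗ v)` to the deque, then `fixup()`. -/
def insertOp (s : State M) (v : M) : State M :=
  fixup ⟨s.q ++ [(v, aggB s * v)], s.L, s.R, s.A, s.B⟩

/-- `evict()`: remove the front element `deque[0]` (each pointer decreases by
one), then `fixup()`. -/
def evictOp (s : State M) : State M :=
  fixup ⟨s.q.tail, s.L - 1, s.R - 1, s.A - 1, s.B - 1⟩

/-- The DABA partial-aggregate invariants, where the window contents are the
`val` fields `w = q.map Prod.fst`. -/
def AggInv (s : State M) : Prop :=
  (∀ i, i < s.L →
    (s.q.getD i (1, 1)).2 = (((s.q.map Prod.fst).take s.B).drop i).prod) ∧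
  (∀ i, s.L ≤ i → i < s.R →
    (s.q.getD i (1, 1)).2 = (((s.q.map Prod.fst).take s.R).drop i).prod) ∧
  (∀ i, s.R ≤ i → i < s.A →
    (s.q.getD i (1, 1)).2 = (((s.q.map Prod.fst).take (i + 1)).drop s.R).prod) ∧
  (∀ i, s.A ≤ i → i < s.B →
    (s.q.getD i (1, 1)).2 = (((s.q.map Prod.fst).take s.B).drop i).prod) ∧
  (∀ i, s.B ≤ i → i < s.q.length →
    (s.q.getD i (1, 1)).2 = (((s.q.map Prod.fst).take (i + 1)).drop s.B).prod)

/-- The DABA size invariants: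
`(|l_F| = 0 ∧ |l_B| = 0) ∨ (|l_L| + |l_R| + |l_A| + 1 = |l_F| − |l_B| ∧ |l_L| = |l_R|)`
with `|l_F| = B`, `|l_L| = R − L`, `|l_R| = A − R`, `|l_A| = B − A`,
`|l_B| = n − B`; subtraction is exact. -/
def SizeInv (s : State M) : Prop :=
  (s.B = 0 ∧ s.q.length = 0) ∨
  ((s.R - s.L) + (s.A - s.R) + (s.B - s.A) + 1 + (s.q.length - s.B) = s.B ∧
    s.R - s.L = s.A - s.R)

/-- The full DABA invariant for window contents `vals`: the `val` fields list
exactly `vals`, the pointers are ordered, and both the partial-aggregate and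
size invariants hold. -/
def Inv (s : State M) (vals : List M) : Prop :=
  s.q.map Prod.fst = vals ∧
  s.L ≤ s.R ∧ s.R ≤ s.A ∧ s.A ≤ s.B ∧ s.B ≤ s.q.length ∧
  AggInv s ∧ SizeInv s

def P (w : List M) (i j : ℕ) : M := ((w.take j).drop i).prod

theorem P_mul (w : List M) {i j k : ℕ} (hij : i ≤ j) (hjk : j ≤ k) (hk : k ≤ w.length) :
    P w i j * P w j k = P w i k := by
  unfold P
  rw [← List.prod_append]
  congr 1
  conv_rhs => rw [← List.take_append_drop j (w.take k)]
  rw [List.take_take, min_eq_left hjk, List.drop_append_of_le_length]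
  rw [List.length_take]; omega

theorem P_self (w : List M) (i : ℕ) : P w i i = 1 := by
  unfold P
  rw [List.drop_eq_nil_of_le (by simp), List.prod_nil]

theorem P_tail (w : List M) (i j : ℕ) : P w.tail i j = P w (i+1) (j+1) := by
  unfold P
  cases w <;> simp

theorem P_append (w : List M) (v : M) (i j : ℕ) (hj : j ≤ w.length) :
    P (w ++ [v]) i j = P w i j := by
  unfold P
  rw [List.take_append_of_le_length hj]

theorem P_one (q : List (M × M)) (i : ℕ) (hi : i < q.length) :
    P (q.map Prod.fst) i (i+1) = (q.getD i (1,1)).1 := by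
  unfold P
  rw [List.take_succ_eq_append_getElem (by simpa using hi), List.drop_append_of_le_length (by simp; omega),
    List.drop_eq_nil_of_le (by simp)]
  simp [List.getElem?_eq_getElem hi]

theorem setAgg_length (q : List (M × M)) (k : ℕ) (x : M) : (setAgg q k x).length = q.length := by
  simp [setAgg]

theorem setAgg_map (q : List (M × M)) (k : ℕ) (x : M) :
    (setAgg q k x).map Prod.fst = q.map Prod.fst := by
  unfold setAgg
  rw [List.map_set]
  apply List.ext_getElem
  · simp
  · intro i h1 h2
    simp at h1 h2
    rw [List.getElem_set]
    split_ifs with h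
    · subst h; simp [List.getElem?_eq_getElem h2]
    · rfl

theorem setAgg_same (q : List (M × M)) (k : ℕ) (x : M) (hk : k < q.length) :
    ((setAgg q k x).getD k (1,1)).2 = x := by
  simp [setAgg, hk]

theorem setAgg_ne (q : List (M × M)) (k i : ℕ) (x : M) (hk : k ≠ i) :
    ((setAgg q k x).getD i (1,1)) = q.getD i (1,1) := by
  simp [setAgg, List.getElem?_set_ne hk]

theorem aggInv_iff (s : State M) : AggInv s ↔
  (∀ i, i < s.L → (s.q.getD i (1, 1)).2 = P (s.q.map Prod.fst) i s.B) ∧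
  (∀ i, s.L ≤ i → i < s.R → (s.q.getD i (1, 1)).2 = P (s.q.map Prod.fst) i s.R) ∧
  (∀ i, s.R ≤ i → i < s.A → (s.q.getD i (1, 1)).2 = P (s.q.map Prod.fst) s.R (i+1)) ∧
  (∀ i, s.A ≤ i → i < s.B → (s.q.getD i (1, 1)).2 = P (s.q.map Prod.fst) i s.B) ∧
  (∀ i, s.B ≤ i → i < s.q.length →
    (s.q.getD i (1, 1)).2 = P (s.q.map Prod.fst) s.B (i+1)) := Iff.rfl

theorem shift_inv (s : State M) (hRA : s.R = s.A) (hLR : s.L = s.R)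
    (hAB : s.A < s.B) (hBn : s.B ≤ s.q.length) (hn : s.q.length = s.B + s.L) (h : AggInv s) :
    Inv ⟨s.q, s.L + 1, s.R + 1, s.A + 1, s.B⟩ (s.q.map Prod.fst) := by
  rw [aggInv_iff] at h
  obtain ⟨h1, h2, h3, h4, h5⟩ := h
  refine ⟨rfl, ?_, ?_, ?_, hBn, ?_, ?_⟩
  · simp; omega
  · simp; omega
  · simp; omega
  · rw [aggInv_iff]
    refine ⟨?_, ?_, ?_, ?_, ?_⟩ <;> dsimp only
    · intro i hi
      by_cases hiL : i < s.L
      · exact h1 i hiL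
      · exact h4 i (by omega) (by omega)
    · intro i _ _; omega
    · intro i _ _; omega
    · intro i _ _; exact h4 i (by omega) (by omega)
    · exact h5
  · right; dsimp only; omega

theorem shrink_inv (s : State M) (hLR : s.L < s.R) (hRA : s.R < s.A)
    (hAB : s.A ≤ s.B) (hBn : s.B ≤ s.q.length) (hn : s.q.length = s.B + s.L)
    (hsz : s.R - s.L = s.A - s.R) (h : AggInv s) (q1 : List (M × M))
    (hq1 : q1 = setAgg s.q s.L (aggL s * aggR s * aggA s)) :
    Inv ⟨setAgg q1 (s.A - 1) ((q1.getD (s.A - 1) (1, 1)).1 *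
        aggA ⟨q1, s.L + 1, s.R, s.A, s.B⟩), s.L + 1, s.R, s.A - 1, s.B⟩
      (s.q.map Prod.fst) := by
  rw [aggInv_iff] at h
  obtain ⟨h1, h2, h3, h4, h5⟩ := h
  have hwl : (s.q.map Prod.fst).length = s.q.length := by simp
  have hmap : q1.map Prod.fst = s.q.map Prod.fst := by rw [hq1, setAgg_map]
  have hlen : q1.length = s.q.length := by rw [hq1, setAgg_length]
  have hne : ∀ i, s.L ≠ i → q1.getD i (1,1) = s.q.getD i (1,1) := by
    intro i hi; rw [hq1, setAgg_ne _ _ _ _ hi]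
  have eL : aggL s = P (s.q.map Prod.fst) s.L s.R := by
    rw [aggL, if_pos hLR, h2 _ le_rfl hLR]
  have eR : aggR s = P (s.q.map Prod.fst) s.R s.A := by
    rw [aggR, if_pos hRA, h3 _ (by omega) (by omega), Nat.sub_add_cancel (by omega)]
  have eA : aggA s = P (s.q.map Prod.fst) s.A s.B := by
    rw [aggA]
    split_ifs with hh
    · exact h4 _ le_rfl hh
    · rw [show s.A = s.B by omega, P_self]
  have eA2 : aggA (⟨q1, s.L + 1, s.R, s.A, s.B⟩ : State M) = P (s.q.map Prod.fst) s.A s.B := by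
    rw [← eA, aggA, aggA]
    dsimp only
    rw [hne _ (by omega)]
  have hqL : (q1.getD s.L (1,1)).2 = P (s.q.map Prod.fst) s.L s.B := by
    rw [hq1, setAgg_same _ _ _ (by omega), eL, eR, eA, P_mul _ hLR.le hRA.le (by omega),
      P_mul _ (by omega) hAB (by omega)]
  have hval : (q1.getD (s.A - 1) (1,1)).1 * aggA (⟨q1, s.L + 1, s.R, s.A, s.B⟩ : State M)
      = P (s.q.map Prod.fst) (s.A - 1) s.B := by
    rw [eA2, hne _ (by omega), ← P_one _ _ (by omega), Nat.sub_add_cancel (by omega),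
      P_mul _ (by omega) hAB (by omega)]
  rw [hval]
  refine ⟨by rw [setAgg_map, hmap], ?_, ?_, ?_, ?_, ?_, ?_⟩
  · dsimp only; omega
  · dsimp only; omega
  · dsimp only; omega
  · dsimp only; rw [setAgg_length]; omega
  · rw [aggInv_iff]
    refine ⟨?_, ?_, ?_, ?_, ?_⟩ <;> dsimp only <;> rw [setAgg_map, hmap]
    · intro i hi
      rw [setAgg_ne _ _ _ _ (by omega)]
      by_cases hiL : i = s.L
      · rw [hiL, hqL]
      · rw [hne _ (by omega)]; exact h1 i (by omega)
    · intro i _ _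
      rw [setAgg_ne _ _ _ _ (by omega), hne _ (by omega)]
      exact h2 i (by omega) (by omega)
    · intro i _ _
      rw [setAgg_ne _ _ _ _ (by omega), hne _ (by omega)]
      exact h3 i (by omega) (by omega)
    · intro i _ _
      by_cases hiA : i = s.A - 1
      · rw [hiA, setAgg_same _ _ _ (by omega)]
      · rw [setAgg_ne _ _ _ _ (by omega), hne _ (by omega)]
        exact h4 i (by omega) (by omega)
    · rw [setAgg_length, hlen]
      intro i _ _
      rw [setAgg_ne _ _ _ _ (by omega), hne _ (by omega)]
      exact h5 i (by omega) (by omega)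
  · right; dsimp only; rw [setAgg_length]; omega

theorem fixup_inv (s : State M) (hLR : s.L ≤ s.R) (hRA : s.R ≤ s.A)
    (hAB : s.A ≤ s.B) (hBn : s.B ≤ s.q.length) (hn : s.q.length = s.B + s.L)
    (hsz : s.R - s.L = s.A - s.R) (h : AggInv s) (hB : s.B ≠ 0) :
    Inv (fixup s) (s.q.map Prod.fst) := by
  unfold fixup
  simp only [if_neg hB]
  by_cases hLB : s.L = s.B
  · simp only [if_pos hLB]
    rw [if_neg (by omega)]
    refine shrink_inv (⟨s.q, 0, s.R, s.q.length, s.q.length⟩ : State M) (by dsimp only; omega)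
      (by dsimp only; omega) le_rfl le_rfl (by simp) (by dsimp only; omega) ?_ _ rfl
    rw [aggInv_iff] at h ⊢
    obtain ⟨h1, h2, h3, h4, h5⟩ := h
    have hRB : s.R = s.B := by omega
    refine ⟨?_, ?_, ?_, ?_, ?_⟩ <;> dsimp only
    · intro i hi; omega
    · intro i _ _; rw [hRB]; exact h1 i (by omega)
    · intro i _ _; rw [hRB]; exact h5 i (by omega) (by omega)
    · intro i _ _; omega
    · intro i _ _; omega
  · simp only [if_neg hLB]
    by_cases hLR' : s.L = s.R
    · rw [if_pos hLR']
      exact shift_inv s (by omega) hLR' (by omega) hBn hn h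
    · rw [if_neg hLR']
      exact shrink_inv s (by omega) (by omega) hAB hBn hn hsz h _ rfl

theorem insert_evict_preserve (s : State M) (vals : List M) (h : Inv s vals) :
    (∀ v : M, Inv (insertOp s v) (vals ++ [v])) ∧
    (vals ≠ [] → Inv (evictOp s) vals.tail) := by
  obtain ⟨hv, hLR, hRA, hAB, hBn, hagg, hsz⟩ := h
  subst hv
  rw [aggInv_iff] at hagg
  obtain ⟨h1, h2, h3, h4, h5⟩ := hagg
  have hwl : (s.q.map Prod.fst).length = s.q.length := by simp
  constructor
  · intro v
    rcases hsz with ⟨hB, hl⟩ | ⟨hs1, hs2⟩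
    · have hq : s.q = [] := List.length_eq_zero_iff.mp hl
      simp only [insertOp, fixup, hB, hq, aggB]
      refine ⟨by simp, by simp, by simp, by simp, by simp, ?_, ?_⟩
      · rw [aggInv_iff]
        refine ⟨?_, ?_, ?_, ?_, ?_⟩ <;> simp [P] <;> intros <;> omega
      · right; simp
    · have e : s.q.map Prod.fst ++ [v] = (s.q ++ [(v, aggB s * v)]).map Prod.fst := by simp
      have hlt : ∀ i, i < s.q.length →
          (s.q ++ [(v, aggB s * v)]).getD i (1,1) = s.q.getD i (1,1) := by
        intro i hi; exact List.getD_append _ _ _ _ hi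
      have hlast : ((s.q ++ [(v, aggB s * v)]).getD s.q.length (1,1)) = (v, aggB s * v) := by simp
      have eB : aggB s = P (s.q.map Prod.fst) s.B s.q.length := by
        rw [aggB]
        split_ifs with hh
        · rw [h5 _ (by omega) (by omega), Nat.sub_add_cancel (by omega)]
        · rw [show s.B = s.q.length by omega, P_self]
      have hl : (s.q ++ [(v, aggB s * v)]).length = s.q.length + 1 := by simp
      rw [e]
      refine fixup_inv (⟨s.q ++ [(v, aggB s * v)], s.L, s.R, s.A, s.B⟩ : State M) hLR hRA hAB
        (by dsimp only; omega) (by dsimp only; omega) hs2 ?_ (by dsimp only; omega)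
      rw [aggInv_iff]
      refine ⟨?_, ?_, ?_, ?_, ?_⟩ <;> dsimp only
      · intro i _
        rw [← e, hlt _ (by omega), P_append _ _ _ _ (by omega)]; exact h1 i (by omega)
      · intro i _ _
        rw [← e, hlt _ (by omega), P_append _ _ _ _ (by omega)]; exact h2 i (by omega) (by omega)
      · intro i _ _
        rw [← e, hlt _ (by omega), P_append _ _ _ _ (by omega)]; exact h3 i (by omega) (by omega)
      · intro i _ _
        rw [← e, hlt _ (by omega), P_append _ _ _ _ (by omega)]; exact h4 i (by omega) (by omega)
      · intro i _ _
        by_cases hi : i < s.q.length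
        · rw [← e, hlt _ (by omega), P_append _ _ _ _ (by omega)]; exact h5 i (by omega) (by omega)
        · have hi' : i = s.q.length := by omega
          rw [hi', ← P_mul _ hBn (Nat.le_succ _) (by rw [List.length_map, hl]),
            P_one _ _ (by omega), hlast, ← e, P_append _ _ _ _ (by omega), ← eB]
  · intro hne
    have hpos : 0 < s.q.length := by
      rw [List.length_pos_iff]; intro h0; apply hne; simp [h0]
    rcases hsz with ⟨hB, hl⟩ | ⟨hs1, hs2⟩
    · omega
    have e : (s.q.map Prod.fst).tail = s.q.tail.map Prod.fst := by simp
    have hl : s.q.tail.length = s.q.length - 1 := by simp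
    have ht : ∀ i, s.q.tail.getD i (1,1) = s.q.getD (i+1) (1,1) := by
      intro i; cases s.q <;> simp
    rw [e]
    by_cases hB : s.B - 1 = 0
    · have hq : s.q.tail = [] := List.length_eq_zero_iff.mp (by omega)
      simp only [evictOp, fixup, hB, hq]
      refine ⟨by simp, by simp, by simp, by simp, by simp, ?_, ?_⟩
      · rw [aggInv_iff]
        refine ⟨?_, ?_, ?_, ?_, ?_⟩ <;> simp
      · left; simp
    · refine fixup_inv (⟨s.q.tail, s.L - 1, s.R - 1, s.A - 1, s.B - 1⟩ : State M)
        (by dsimp only; omega) (by dsimp only; omega) (by dsimp only; omega)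
        (by dsimp only; omega) (by dsimp only; omega) (by dsimp only; omega) ?_ hB
      have eB : s.B - 1 + 1 = s.B := by omega
      have eR : s.R - 1 + 1 = s.R := by omega
      rw [aggInv_iff]
      refine ⟨?_, ?_, ?_, ?_, ?_⟩ <;> dsimp only <;> intros <;>
        rw [← e, ht, P_tail]
      · rw [eB]; exact h1 _ (by omega)
      · rw [eR]; exact h2 _ (by omega) (by omega)
      · rw [eR]; exact h3 _ (by omega) (by omega)
      · rw [eB]; exact h4 _ (by omega) (by omega)
      · rw [eB]; exact h5 _ (by omega) (by omega)

end Daba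
end

section
/- In DABA Lite, each call to query invokes ⊗ at most one time, each call to insert invokes ⊗ at most three times, and each call to evict invokes ⊗ at most two times. Moreover, in any execution in which the window remains nonempty, between two consecutive executions of the flip case of fixup the number of fixup calls executing the shrink case equals the number executing the shift case; since shrink invokes ⊗ exactly twice and shift, flip, and singleton invoke ⊗ zero times, over such a span of 2m fixup calls the total number of ⊗ invocations inside fixup is 2m (an average of one per fixup call, hence an average of two ⊗ invocations per insert and one per evict). -/
/-!
STATEMENT 17: In DABA Lite, each call to query invokes `⊗` at most one time,
each call to insert invokes `⊗` at most three times, and each call to evict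
invokes `⊗` at most two times. Moreover, in any execution in which the window
remains nonempty, between two consecutive executions of the flip case of fixup
the number of fixup calls executing the shrink case equals the number executing
the shift case; since shrink invokes `⊗` exactly twice and shift, flip, and
singleton invoke `⊗` zero times, over such a span of `2m` fixup calls the total
number of `⊗` invocations inside fixup is `2m` (an average of one per fixup
call, hence an average of two `⊗` invocations per insert and one per evict).
-/

namespace DabaLite

variable {M : Type*} [Monoid M]

/-- A DABA Lite state. -/
structure State (M : Type*) where
  q : List M
  L : ℕ
  R : ℕ
  A : ℕ
  B : ℕ
  aggRA : M
  aggB : M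

/-- `aggL = deque[L]` if `L < R`, `1` otherwise. -/
def aggL (s : State M) : M := if s.L < s.R then s.q.getD s.L 1 else 1

/-- `aggA = deque[A]` if `A < B`, `1` otherwise. -/
def aggA (s : State M) : M := if s.A < s.B then s.q.getD s.A 1 else 1

/-- The state immediately after the flip pointer updates
`L ← 0, A ← n, B ← n, aggRA ← aggB, aggB ← 1` (with `R` unchanged). -/
def flipped (s : State M) : State M :=
  ⟨s.q, 0, s.R, s.q.length, s.q.length, s.aggB, 1⟩

/-- `fixup()`. -/
def fixup (s : State M) : State M :=
  let n := s.q.length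
  if s.B = 0 then ⟨s.q, n, n, n, n, 1, 1⟩
  else
    let s1 : State M := if s.L = s.B then flipped s else s
    if s1.L = s1.R then
      ⟨s1.q, s1.L + 1, s1.R + 1, s1.A + 1, s1.B, s1.aggRA, s1.aggB⟩
    else
      let s2 : State M :=
        ⟨s1.q.set s1.L (aggL s1 * s1.aggRA), s1.L + 1, s1.R, s1.A, s1.B,
          s1.aggRA, s1.aggB⟩
      ⟨s2.q.set (s2.A - 1) (s2.q.getD (s2.A - 1) 1 * aggA s2),
        s2.L, s2.R, s2.A - 1, s2.B, s2.aggRA, s2.aggB⟩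

/-- Number of `⊗` invocations made by a `fixup()` call: two in the shrink case
(one for `deque[L] ← aggL ⊗ aggRA` and one for
`deque[A−1] ← deque[A−1] ⊗ aggA`); zero in the singleton, flip, and shift
cases. -/
def fixupCost (s : State M) : ℕ :=
  if s.B = 0 then 0
  else
    let s1 : State M := if s.L = s.B then flipped s else s
    if s1.L = s1.R then 0 else 2

/-- `query()` returns `aggF ⊗ aggB`: one `⊗` invocation. -/
def queryCost (_s : State M) : ℕ := 1

/-- `insert(v)`: one `⊗` invocation for `aggB ← aggB ⊗ v`, plus the cost of
`fixup()` on the pushed state. -/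
def insertCost (s : State M) (v : M) : ℕ :=
  1 + fixupCost (⟨s.q ++ [v], s.L, s.R, s.A, s.B, s.aggRA, s.aggB * v⟩ : State M)

/-- `evict()`: the cost of `fixup()` on the popped state. -/
def evictCost (s : State M) : ℕ :=
  fixupCost (⟨s.q.tail, s.L - 1, s.R - 1, s.A - 1, s.B - 1, s.aggRA,
    s.aggB⟩ : State M)

/-- Window operations: insert a value, or evict the oldest value. -/
inductive DOp (M : Type*) where
  | ins (v : M)
  | evict

/-- The state just before the `fixup()` call of an operation. -/
def preFix (s : State M) : DOp M → State M
  | .ins v => ⟨s.q ++ [v], s.L, s.R, s.A, s.B, s.aggRA, s.aggB * v⟩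
  | .evict => ⟨s.q.tail, s.L - 1, s.R - 1, s.A - 1, s.B - 1, s.aggRA, s.aggB⟩

/-- A complete insert or evict operation. -/
def applyOp (s : State M) (o : DOp M) : State M := fixup (preFix s o)

/-- The DABA Lite size invariants, with exact subtraction. -/
def SizeInv (s : State M) : Prop :=
  (s.B = 0 ∧ s.q.length = 0) ∨
  ((s.R - s.L) + (s.A - s.R) + (s.B - s.A) + 1 + (s.q.length - s.B) = s.B ∧
    s.R - s.L = s.A - s.R)

/-- This fixup call executes the flip case. -/
def ExecFlip (p : State M) : Prop := p.B ≠ 0 ∧ p.L = p.B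

/-- This fixup call executes the shrink case (possibly after a flip). -/
def execShrink (p : State M) : Bool :=
  p.B != 0 &&
    (let s1 : State M := if p.L = p.B then flipped p else p
     s1.L != s1.R)

/-- This fixup call executes the shift case. -/
def execShift (p : State M) : Bool :=
  p.B != 0 &&
    (let s1 : State M := if p.L = p.B then flipped p else p
     s1.L == s1.R)

def Inv (r k : ℕ) (s : State M) : Prop :=
  1 ≤ s.L ∧ s.L + 2 * r = s.B + k ∧ s.R = s.L + (r - k) ∧ s.A = s.R + (r - k) ∧ k ≤ 2 * r

def Counts (r k : ℕ) (p : State M) : Prop :=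
  (execShrink p = true ↔ k < r) ∧ (execShift p = true ↔ r ≤ k) ∧
    fixupCost p = if k < r then 2 else 0

theorem fixupCost_le_two (s : State M) : fixupCost s ≤ 2 := by
  unfold fixupCost
  dsimp only
  split_ifs <;> omega

theorem step_fix (r k : ℕ) (p : State M) (hB : p.B ≠ 0) (h1 : p.L + 2 * r = p.B + k)
    (h2 : p.R = p.L + (r - k)) (h3 : p.A = p.R + (r - k)) (hk : k < 2 * r) :
    Inv r (k + 1) (fixup p) ∧ Counts r k p := by
  have hLB : p.L ≠ p.B := by omega
  by_cases hLR : p.L = p.R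
  · refine ⟨?_, ?_, ?_, ?_⟩
    · simp only [fixup, Inv, hB, hLB, if_false]
      simp only [if_pos hLR]
      omega
    · simp only [execShrink, hLB, if_false, Bool.and_eq_true, bne_iff_ne]; omega
    · simp only [execShift, hLB, if_false, Bool.and_eq_true, bne_iff_ne, beq_iff_eq]; omega
    · simp only [fixupCost, hB, hLB, if_false]
      split_ifs <;> omega
  · refine ⟨?_, ?_, ?_, ?_⟩
    · simp only [fixup, Inv, hB, hLB, hLR, if_false]
      omega
    · simp [execShrink, hB, hLB, hLR]; omega
    · simp [execShift, hB, hLB, hLR]; omega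
    · simp only [fixupCost, hB, hLB, hLR, if_false]
      split_ifs <;> omega

theorem step (r k : ℕ) (s : State M) (o : DOp M) (h : Inv r k s) (hk : k < 2 * r) :
    Inv r (k + 1) (applyOp s o) ∧ Counts r k (preFix s o) := by
  obtain ⟨h0, h1, h2, h3, h4⟩ := h
  cases o
  · exact step_fix r k _ (by simp only [preFix]; omega) (by simp only [preFix]; omega)
      (by simp only [preFix]; omega) (by simp only [preFix]; omega) hk
  · exact step_fix r k _ (by simp only [preFix]; omega) (by simp only [preFix]; omega)
      (by simp only [preFix]; omega) (by simp only [preFix]; omega) hk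

theorem start (p : State M) (hf : ExecFlip p) (hq : (fixup p).q ≠ [])
    (hs : SizeInv (fixup p)) :
    ∃ r, 0 < r ∧ Inv r 1 (fixup p) ∧ Counts r 0 p := by
  obtain ⟨hB, hLB⟩ := hf
  by_cases hR : 0 = p.R
  · exfalso
    have e : fixup p = ⟨p.q, 0 + 1, p.R + 1, p.q.length + 1, p.q.length, p.aggB, 1⟩ := by
      simp [fixup, hB, hLB, flipped, ← hR]
    rw [e] at hs hq
    have : p.q.length ≠ 0 := by simpa using hq
    simp only [SizeInv] at hs
    omega
  · have hl : (fixup p).q.length = p.q.length := by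
      simp [fixup, hB, hLB, flipped, hR]
    have eL : (fixup p).L = 1 := by simp [fixup, hB, hLB, flipped, hR]
    have eR : (fixup p).R = p.R := by simp [fixup, hB, hLB, flipped, hR]
    have eA : (fixup p).A = p.q.length - 1 := by simp [fixup, hB, hLB, flipped, hR]
    have eB : (fixup p).B = p.q.length := by simp [fixup, hB, hLB, flipped, hR]
    have hn : p.q.length ≠ 0 := by
      rw [← hl]; simpa using hq
    simp only [SizeInv, hl, eL, eR, eA, eB] at hs
    refine ⟨p.R, by omega, ?_, ?_, ?_, ?_⟩
    · simp only [Inv, eL, eR, eA, eB]; omega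
    · simp [execShrink, hB, hLB, flipped, hR]; omega
    · simp [execShift, hB, hLB, flipped]; omega
    · simp only [fixupCost, hB, hLB, flipped, hR, if_true, if_false]
      split_ifs <;> omega

theorem flip_end (r : ℕ) (s : State M) (o : DOp M) (h : Inv r (2 * r) s) (hr : 0 < r)
    (hs : SizeInv s) (hq : (applyOp s o).q ≠ []) : ExecFlip (preFix s o) := by
  obtain ⟨h0, h1, h2, h3, h4⟩ := h
  simp only [SizeInv] at hs
  cases o with
  | ins v => simp only [preFix, ExecFlip]; omega
  | evict =>
    by_cases hB : s.B = 1
    · exfalso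
      apply hq
      simp only [applyOp, preFix, fixup, hB]
      simp only [Nat.sub_self, if_true]
      apply List.eq_nil_of_length_eq_zero
      rw [List.length_tail]
      omega
    · simp only [preFix, ExecFlip]; omega

theorem not_flip (r k : ℕ) (s : State M) (o : DOp M) (h : Inv r k s) (hk : k < 2 * r) :
    ¬ ExecFlip (preFix s o) := by
  obtain ⟨h0, h1, h2, h3, h4⟩ := h
  cases o <;> simp only [preFix, ExecFlip] <;> omega

theorem sum_lt (c m j : ℕ) :
    (∑ k ∈ Finset.range j, if k < m then c else 0) = c * min j m := by
  induction j with
  | zero => simp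
  | succ j ih =>
    rw [Finset.sum_range_succ, ih]
    split_ifs with h
    · rw [min_eq_left (by omega), min_eq_left (by omega)]; ring
    · rw [min_eq_right (by omega), min_eq_right (by omega)]; ring

theorem sum_ge (m j : ℕ) :
    (∑ k ∈ Finset.range j, if m ≤ k then 1 else 0) = j - m := by
  induction j with
  | zero => simp
  | succ j ih =>
    rw [Finset.sum_range_succ, ih]
    split_ifs <;> omega

theorem costs_and_cycle (m : ℕ) (hm : 0 < m)
    (trace : ℕ → State M) (ops : ℕ → DOp M)
    -- the execution: each step performs an insert or evict
    (hstep : ∀ k, k ≤ 2 * m → trace (k + 1) = applyOp (trace k) (ops k))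
    -- the window remains nonempty
    (hne : ∀ k, k ≤ 2 * m + 1 → (trace k).q ≠ [])
    -- the size invariants hold before and after every operation
    (hsize : ∀ k, k ≤ 2 * m + 1 → SizeInv (trace k))
    -- fixup calls 0 and 2m are two consecutive executions of the flip case:
    (hflip0 : ExecFlip (preFix (trace 0) (ops 0)))
    (hflipN : ExecFlip (preFix (trace (2 * m)) (ops (2 * m))))
    (hnoflip : ∀ k, 0 < k → k < 2 * m → ¬ ExecFlip (preFix (trace k) (ops k))) :
    -- per-operation worst-case bounds
    (∀ s : State M, queryCost s ≤ 1) ∧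
    (∀ (s : State M) (v : M), insertCost s v ≤ 3) ∧
    (∀ s : State M, evictCost s ≤ 2) ∧
    -- between the consecutive flips, #shrink = #shift (= m)
    (∑ k ∈ Finset.range (2 * m),
        (if execShrink (preFix (trace k) (ops k)) then 1 else 0)) = m ∧
    (∑ k ∈ Finset.range (2 * m),
        (if execShift (preFix (trace k) (ops k)) then 1 else 0)) = m ∧
    -- total ⊗ invocations inside these 2m fixup calls is 2m
    (∑ k ∈ Finset.range (2 * m), fixupCost (preFix (trace k) (ops k))) = 2 * m := by
  refine ⟨fun _ => le_rfl, fun s v => ?_, fun s => fixupCost_le_two _, ?_⟩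
  · have := fixupCost_le_two
      (⟨s.q ++ [v], s.L, s.R, s.A, s.B, s.aggRA, s.aggB * v⟩ : State M)
    unfold insertCost
    omega
  have e1 : trace 1 = fixup (preFix (trace 0) (ops 0)) := hstep 0 (by omega)
  obtain ⟨r, hr, hI1, hC0⟩ := start _ hflip0 (e1 ▸ hne 1 (by omega)) (e1 ▸ hsize 1 (by omega))
  rw [← e1] at hI1
  have hI : ∀ k, k + 1 ≤ 2 * r → k + 1 ≤ 2 * m → Inv r (k + 1) (trace (k + 1)) := by
    intro k
    induction k with
    | zero => intro _ _; exact hI1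
    | succ k ih =>
      intro a b
      rw [hstep (k + 1) (by omega)]
      exact (step r (k + 1) _ _ (ih (by omega) (by omega)) (by omega)).1
  have hrm : r = m := by
    rcases lt_trichotomy r m with h | h | h
    · exfalso
      have := hI (2 * r - 1) (by omega) (by omega)
      rw [show 2 * r - 1 + 1 = 2 * r by omega] at this
      refine hnoflip (2 * r) (by omega) (by omega)
        (flip_end r _ _ this hr (hsize _ (by omega)) ?_)
      rw [← hstep _ (by omega)]
      exact hne _ (by omega)
    · exact h
    · exfalso
      have := hI (2 * m - 1) (by omega) (by omega)
      rw [show 2 * m - 1 + 1 = 2 * m by omega] at this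
      exact not_flip r _ _ _ this (by omega) hflipN
  subst hrm
  have hC : ∀ k ∈ Finset.range (2 * r), Counts r k (preFix (trace k) (ops k)) := by
    intro k hk
    rw [Finset.mem_range] at hk
    cases k with
    | zero => exact hC0
    | succ k => exact (step r (k + 1) _ _ (hI k (by omega) (by omega)) hk).2
  refine ⟨?_, ?_, ?_⟩
  · rw [Finset.sum_congr rfl (fun k hk => if_congr (hC k hk).1 rfl rfl), sum_lt]
    omega
  · rw [Finset.sum_congr rfl (fun k hk => if_congr (hC k hk).2.1 rfl rfl), sum_ge]
    omega
  · rw [Finset.sum_congr rfl (fun k hk => (hC k hk).2.2), sum_lt]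
    omega


end DabaLite
end
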